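/- arXiv:1007.4424 — 2 statements merged into one kernel-verified Lean document; each statement's English description precedes it below -/
import Mathlib

section
/- Let a, b, c, d > 0, let f : (0,∞) → ℝ be continuous, assume c > f(a/b), and set y* = a/b, x* = (c − f(y*))/d. Let (x(t), y(t)) be a differentiable solution of x' = x(a − b y), y' = y(−c + d x + f(y)) with x(t) > 0 and y(t) > 0 on an interval I. Define V(x,y) = d(x − x* ln x) + b(y − y* ln y). Then for every t ∈ I, the derivative of t ↦ V(x(t), y(t)) equals b (y(t) − y*) (f(y(t)) − f(y*)). -/
/-- **Derivative of the Lyapunov function along solutions.**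
For the Lotka–Volterra type system `x' = x(a - b y)`, `y' = y(-c + d x + f(y))` with
positive constants and equilibrium `(x*, y*) = ((c - f(a/b))/d, a/b)`, along any positive
solution defined on an interval `I`, the function
`V(x,y) = d(x - x* ln x) + b(y - y* ln y)` satisfies
`dV/dt = b (y - y*) (f(y) - f(y*))`. -/
theorem lotka_volterra_lyapunov_derivative
    (a b c d : ℝ) (ha : 0 < a) (hb : 0 < b) (hc : 0 < c) (hd : 0 < d)
    (f : ℝ → ℝ) (hf : ContinuousOn f (Set.Ioi 0)) (hcf : f (a / b) < c)
    (xstar ystar : ℝ) (hy : ystar = a / b) (hx : xstar = (c - f ystar) / d)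
    (I : Set ℝ) (x y : ℝ → ℝ)
    (hpos : ∀ t ∈ I, 0 < x t ∧ 0 < y t)
    (hxode : ∀ t ∈ I, HasDerivAt x (x t * (a - b * y t)) t)
    (hyode : ∀ t ∈ I, HasDerivAt y (y t * (-c + d * x t + f (y t))) t) :
    ∀ t ∈ I,
      HasDerivAt
        (fun s => d * (x s - xstar * Real.log (x s)) + b * (y s - ystar * Real.log (y s)))
        (b * (y t - ystar) * (f (y t) - f ystar)) t := by
  intro t ht
  obtain ⟨hxp, hyp⟩ := hpos t ht
  have h1 := hxode t ht
  have h2 := hyode t ht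
  have hA : a = b * ystar := by rw [hy]; field_simp
  have hC : c = d * xstar + f ystar := by rw [hx]; field_simp; ring
  have key := ((h1.sub ((h1.log hxp.ne').const_mul xstar)).const_mul d).add
    ((h2.sub ((h2.log hyp.ne').const_mul ystar)).const_mul b)
  refine key.congr_deriv ?_
  rw [mul_div_cancel_left₀ _ hxp.ne', mul_div_cancel_left₀ _ hyp.ne']
  linear_combination d * (x t - xstar) * hA - b * (y t - ystar) * hC
end

section
/- Let a, b, c, d > 0, let f : (0,∞) → ℝ be continuous, assume c > f(a/b), and set y* = a/b, x* = (c − f(y*))/d. Assume the strict sign condition (y − y*)(f(y) − f(y*)) > 0 for all y > 0 with y ≠ y* (or, alternatively, (y − y*)(f(y) − f(y*)) < 0 for all y > 0 with y ≠ y*). Then every periodic solution (x(t), y(t)) of the system x' = x(a − b y), y' = y(−c + d x + f(y)) with x(t) > 0 and y(t) > 0 for all t is constant, i.e., equal to the equilibrium (x*, y*); in particular the system has no cycles in the positive quadrant. -/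
theorem periodic_mono_aux (g g' : ℝ → ℝ) (hg : ∀ t, HasDerivAt g (g' t) t)
    (h0 : ∀ t, 0 ≤ g' t) (T : ℝ) (hT : 0 < T) (hp : ∀ t, g (t + T) = g t) :
    ∀ t, g' t = 0 := by
  have hm : Monotone g := by
    apply monotone_of_deriv_nonneg (fun t => (hg t).differentiableAt)
    intro t
    rw [(hg t).deriv]
    exact h0 t
  intro t
  have he : g =ᶠ[nhds t] fun _ => g t := by
    filter_upwards [Ioo_mem_nhds (show t - T < t by linarith) (show t < t + T by linarith)]
      with s hs
    have h1 := hm hs.1.le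
    have h2 := hm hs.2.le
    have h3 := hp t
    have h4 := hp (t - T)
    rw [sub_add_cancel] at h4
    linarith
  exact (hg t).unique ((hasDerivAt_const t (g t)).congr_of_eventuallyEq he)

/-- **No cycles under a strict sign condition.**
For the Lotka–Volterra type system `x' = x(a - b y)`, `y' = y(-c + d x + f(y))` with
positive constants, equilibrium `(x*, y*) = ((c - f(a/b))/d, a/b)`, if
`(y - y*)(f(y) - f(y*))` has a strict constant sign for all positive `y ≠ y*`, then every
positive periodic solution is constant, equal to the equilibrium; in particular there is
no cycle in the positive quadrant. -/
theorem lotka_volterra_no_cycles_of_sign_condition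
    (a b c d : ℝ) (ha : 0 < a) (hb : 0 < b) (hc : 0 < c) (hd : 0 < d)
    (f : ℝ → ℝ) (hf : ContinuousOn f (Set.Ioi 0)) (hcf : f (a / b) < c)
    (xstar ystar : ℝ) (hy : ystar = a / b) (hx : xstar = (c - f ystar) / d)
    (hsign : (∀ y : ℝ, 0 < y → y ≠ ystar → 0 < (y - ystar) * (f y - f ystar)) ∨
             (∀ y : ℝ, 0 < y → y ≠ ystar → (y - ystar) * (f y - f ystar) < 0))
    (x y : ℝ → ℝ)
    (hpos : ∀ t, 0 < x t ∧ 0 < y t)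
    (hxode : ∀ t, HasDerivAt x (x t * (a - b * y t)) t)
    (hyode : ∀ t, HasDerivAt y (y t * (-c + d * x t + f (y t))) t)
    (hper : ∃ T > (0:ℝ), ∀ t, x (t + T) = x t ∧ y (t + T) = y t) :
    ∀ t, x t = xstar ∧ y t = ystar := by
  obtain ⟨T, hT, hp⟩ := hper
  have hay : a = b * ystar := by rw [hy]; field_simp
  have hcx : c = d * xstar + f ystar := by rw [hx]; field_simp; ring
  have hV : ∀ t, HasDerivAt
      (fun t => d * (x t - xstar * Real.log (x t)) + b * (y t - ystar * Real.log (y t)))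
      (b * ((y t - ystar) * (f (y t) - f ystar))) t := by
    intro t
    have hxt := (hpos t).1.ne'
    have hyt := (hpos t).2.ne'
    have h1 := ((hxode t).sub (((hxode t).log hxt).const_mul xstar)).const_mul d
    have h2 := ((hyode t).sub (((hyode t).log hyt).const_mul ystar)).const_mul b
    refine (h1.add h2).congr_deriv ?_
    rw [mul_div_cancel_left₀ _ hxt, mul_div_cancel_left₀ _ hyt, hcx, hay]
    ring
  have key : ∀ t, b * ((y t - ystar) * (f (y t) - f ystar)) = 0 := by
    rcases hsign with hs | hs
    · refine periodic_mono_aux _ _ hV ?_ T hT ?_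
      · intro t
        by_cases h : y t = ystar
        · simp [h]
        · exact (mul_pos hb (hs _ (hpos t).2 h)).le
      · intro t
        simp only [(hp t).1, (hp t).2]
    · intro t
      refine neg_eq_zero.mp (periodic_mono_aux _ _ (fun t => (hV t).neg) ?_ T hT ?_ t)
      · intro t
        by_cases h : y t = ystar
        · simp [h]
        · have := mul_neg_of_pos_of_neg hb (hs _ (hpos t).2 h)
          linarith
      · intro t
        simp only [Pi.neg_apply, (hp t).1, (hp t).2]
  have hyc : ∀ t, y t = ystar := by
    intro t
    by_contra h
    have h0 := (mul_eq_zero.mp (key t)).resolve_left hb.ne'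
    rcases hsign with hs | hs
    · exact (hs _ (hpos t).2 h).ne' h0
    · exact (hs _ (hpos t).2 h).ne h0
  intro t
  refine ⟨?_, hyc t⟩
  have hfun : y = fun _ => ystar := funext hyc
  have h1 := hyode t
  have h2 : HasDerivAt y 0 t := by
    rw [hfun]
    exact hasDerivAt_const t ystar
  have h3 := (mul_eq_zero.mp (h1.unique h2)).resolve_left (hpos t).2.ne'
  rw [hyc t, hcx] at h3
  have h4 : d * (x t - xstar) = 0 := by linarith
  have h5 := (mul_eq_zero.mp h4).resolve_left hd.ne'
  linarith
end
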